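/- arXiv:2102.04594 — 5 statements merged into one kernel-verified Lean document; each statement's English description precedes it below -/
import Mathlib

section
/- Let X, Y, A be finite nonempty sets, μ a prior on X, α a stochastic kernel from X to Y (an attention strategy), u : X × A → ℝ a utility, and β an optimal decision rule for (μ, α, u). Then the revealed joint distribution q of (μ, α, β) satisfies NIAS for u, i.e. for all a, b ∈ A, ∑_{x∈X} q(x,a) (u(x,b) − u(x,a)) ≤ 0. -/
open Finset

/-- A stochastic kernel from `S` to `T`: `κ s t` is the probability of `t` given `s`. -/
def IsKernel {S T : Type*} [Fintype T] (κ : S → T → ℝ) : Prop :=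
  (∀ s t, 0 ≤ κ s t) ∧ ∀ s, ∑ t, κ s t = 1

/-- A prior on a finite set `X`. -/
def IsPrior {X : Type*} [Fintype X] (μ : X → ℝ) : Prop :=
  (∀ x, 0 ≤ μ x) ∧ ∑ x, μ x = 1

/-- Maximum of a real-valued function over a finite nonempty type. -/
noncomputable def maxOver {A : Type*} [Fintype A] [Nonempty A] (f : A → ℝ) : ℝ :=
  Finset.univ.sup' Finset.univ_nonempty f

/-- Maximal expected utility of attention strategy `α` under prior `μ` and utility `u`. -/
noncomputable def J {X Y A : Type*} [Fintype X] [Fintype Y] [Fintype A] [Nonempty A]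
    (μ : X → ℝ) (α : X → Y → ℝ) (u : X → A → ℝ) : ℝ :=
  ∑ y, maxOver (fun a => ∑ x, μ x * α x y * u x a)

/-- Maximal expected utility of a direct strategy `p : X → A`. -/
noncomputable def JA {X A : Type*} [Fintype X] [Fintype A] [Nonempty A]
    (μ : X → ℝ) (p : X → A → ℝ) (u : X → A → ℝ) : ℝ :=
  ∑ a, maxOver (fun b => ∑ x, μ x * p x a * u x b)

/-- `β` is an optimal decision rule for `(μ, α, u)`. -/
def OptimalRule {X Y A : Type*} [Fintype X] (μ : X → ℝ) (α : X → Y → ℝ)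
    (u : X → A → ℝ) (β : Y → A → ℝ) : Prop :=
  ∀ y a, 0 < β y a → ∀ b, ∑ x, μ x * α x y * u x b ≤ ∑ x, μ x * α x y * u x a

/-- The NIAS (No-Improving-Action-Switches) inequalities. -/
def NIAS {X A : Type*} [Fintype X] (q u : X → A → ℝ) : Prop :=
  ∀ a b, ∑ x, q x a * (u x b - u x a) ≤ 0

/-- The NIAC (No-Improving-Action-Cycles) inequalities for a collection of agents. -/
def NIAC {K X A : Type*} [Fintype X] [Fintype A] [Nonempty A]
    (q u : K → X → A → ℝ) (c : K → ℝ) : Prop :=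
  ∀ j k, (∑ a, maxOver (fun b => ∑ x, q j x a * u k x b)) - c j
    - (∑ x, ∑ a, q k x a * u k x a) + c k ≤ 0

/-- An optimal decision rule gives revealed data satisfying NIAS. -/
theorem nias_necessity {X Y A : Type*} [Fintype X] [Nonempty X]
    [Fintype Y] [Nonempty Y] [Fintype A] [Nonempty A]
    (μ : X → ℝ) (hμ : IsPrior μ)
    (α : X → Y → ℝ) (hα : IsKernel α)
    (u : X → A → ℝ)
    (β : Y → A → ℝ) (hβ : IsKernel β)
    (hopt : OptimalRule μ α u β) :
    NIAS (fun x a => μ x * ∑ y, β y a * α x y) u := by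
  intro a b
  have hsum : ∑ x, (μ x * ∑ y, β y a * α x y) * (u x b - u x a)
      = ∑ y, β y a * (∑ x, μ x * α x y * u x b - ∑ x, μ x * α x y * u x a) := by
    simp only [← Finset.sum_sub_distrib, Finset.mul_sum, Finset.sum_mul]
    rw [Finset.sum_comm]
    refine Finset.sum_congr rfl fun y _ => Finset.sum_congr rfl fun x _ => ?_
    ring
  rw [hsum]
  refine Finset.sum_nonpos fun y _ => ?_
  rcases (hβ.1 y a).eq_or_lt with h | h
  · simp [← h]
  · exact mul_nonpos_of_nonneg_of_nonpos h.le (sub_nonpos.2 (hopt y a h b))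
end

section
/- (Blackwell dominance monotonicity.) Let X, Y, A be finite nonempty sets, μ a prior on X, α a stochastic kernel from X to Y, β a stochastic kernel from Y to A, and let α′ be the composed stochastic kernel from X to A defined by α′(a|x) = ∑_{y∈Y} β(a|y) α(y|x). Then for every utility u : X × A → ℝ, J_A(μ, α′, u) ≤ J(μ, α, u); that is, garbling an attention strategy cannot increase its maximal expected utility. -/
open Finset

theorem le_maxOver {A : Type*} [Fintype A] [Nonempty A] (f : A → ℝ) (a : A) :
    f a ≤ maxOver f :=
  Finset.le_sup' f (Finset.mem_univ a)

theorem maxOver_le {A : Type*} [Fintype A] [Nonempty A] {f : A → ℝ} {c : ℝ}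
    (h : ∀ a, f a ≤ c) : maxOver f ≤ c :=
  Finset.sup'_le _ f fun a _ => h a

/-- The maximum of a nonnegative combination is at most the combination of the maxima. -/
theorem maxOver_sum_mul_le {Y A : Type*} [Fintype Y] [Fintype A] [Nonempty A]
    {w : Y → ℝ} (hw : ∀ y, 0 ≤ w y) (f : Y → A → ℝ) :
    maxOver (fun a => ∑ y, w y * f y a) ≤ ∑ y, w y * maxOver (f y) :=
  maxOver_le fun a => Finset.sum_le_sum fun y _ =>
    mul_le_mul_of_nonneg_left (le_maxOver (f y) a) (hw y)

/-- Blackwell dominance monotonicity: garbling cannot increase `J`. -/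
theorem blackwell_garbling {X Y A : Type*} [Fintype X] [Nonempty X]
    [Fintype Y] [Nonempty Y] [Fintype A] [Nonempty A]
    (μ : X → ℝ) (hμ : IsPrior μ)
    (α : X → Y → ℝ) (hα : IsKernel α)
    (β : Y → A → ℝ) (hβ : IsKernel β)
    (u : X → A → ℝ) :
    JA μ (fun x a => ∑ y, β y a * α x y) u ≤ J μ α u := by
  have h_garble : ∀ a b, ∑ x, μ x * (∑ y, β y a * α x y) * u x b =
      ∑ y, β y a * ∑ x, μ x * α x y * u x b := by
    intro a b
    simp_rw [Finset.mul_sum, Finset.sum_mul]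
    rw [Finset.sum_comm]
    exact Finset.sum_congr rfl fun y _ => Finset.sum_congr rfl fun x _ => by ring
  unfold JA J
  simp_rw [h_garble]
  refine (Finset.sum_le_sum fun a _ =>
    maxOver_sum_mul_le (fun y => hβ.1 y a) fun y b => ∑ x, μ x * α x y * u x b).trans_eq ?_
  rw [Finset.sum_comm]
  simp_rw [← Finset.sum_mul, hβ.2, one_mul]
end

section
/- Let X, Y, A be finite nonempty sets, μ a prior on X, α a stochastic kernel from X to Y, u : X × A → ℝ a utility, and β an optimal decision rule for (μ, α, u). Let α′(a|x) = ∑_{y∈Y} β(a|y) α(y|x) be the composed kernel and q(x,a) = μ(x) α′(a|x) the revealed joint distribution. Then J_A(μ, α′, u) = J(μ, α, u), and both are equal to the realized expected utility ∑_{x∈X} ∑_{a∈A} q(x,a) u(x,a). -/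
open Finset

theorem maxOver_eq_of_forall_le {A : Type*} [Fintype A] [Nonempty A] {f : A → ℝ} {a : A}
    (h : ∀ b, f b ≤ f a) : maxOver f = f a :=
  le_antisymm (Finset.sup'_le _ _ fun b _ => h b) (Finset.le_sup' f (Finset.mem_univ a))

/-- Expected utility of action `b` on the event that the garbled signal is `a`. -/
theorem sum_garbled_mul {X Y A : Type*} [Fintype X] [Fintype Y]
    (μ : X → ℝ) (α : X → Y → ℝ) (u : X → A → ℝ) (β : Y → A → ℝ) (a b : A) :
    ∑ x, (μ x * ∑ y, β y a * α x y) * u x b = ∑ y, β y a * ∑ x, μ x * α x y * u x b := by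
  simp only [Finset.mul_sum, Finset.sum_mul]
  rw [Finset.sum_comm]
  exact Finset.sum_congr rfl fun y _ => Finset.sum_congr rfl fun x _ => by ring

/-- Under an optimal rule, the actions recommended at each signal attain the maximum. -/
theorem OptimalRule.mul_maxOver {X Y A : Type*} [Fintype X] [Fintype A] [Nonempty A]
    {μ : X → ℝ} {α : X → Y → ℝ} {u : X → A → ℝ} {β : Y → A → ℝ}
    (hopt : OptimalRule μ α u β) (hβ : IsKernel β) (y : Y) (a : A) :
    β y a * maxOver (fun b => ∑ x, μ x * α x y * u x b) =
      β y a * ∑ x, μ x * α x y * u x a := by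
  rcases (hβ.1 y a).eq_or_lt with h | h
  · simp [← h]
  · rw [maxOver_eq_of_forall_le (hopt y a h)]

/-- Under an optimal rule, following the recommendation of the garbled signal is optimal. -/
theorem OptimalRule.maxOver_garbled {X Y A : Type*} [Fintype X] [Fintype Y] [Fintype A]
    [Nonempty A] {μ : X → ℝ} {α : X → Y → ℝ} {u : X → A → ℝ} {β : Y → A → ℝ}
    (hopt : OptimalRule μ α u β) (hβ : IsKernel β) (a : A) :
    maxOver (fun b => ∑ x, (μ x * ∑ y, β y a * α x y) * u x b) =
      ∑ x, (μ x * ∑ y, β y a * α x y) * u x a := by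
  refine maxOver_eq_of_forall_le
    (f := fun b => ∑ x, (μ x * ∑ y, β y a * α x y) * u x b) fun b => ?_
  simp only [sum_garbled_mul]
  refine Finset.sum_le_sum fun y _ => ?_
  rcases (hβ.1 y a).eq_or_lt with h | h
  · simp [← h]
  · exact mul_le_mul_of_nonneg_left (hopt y a h b) h.le

/-- For an optimal decision rule, the garbled strategy has the same maximal
expected utility, which equals the realized expected utility of the revealed data. -/
theorem optimal_rule_no_loss {X Y A : Type*} [Fintype X] [Nonempty X]
    [Fintype Y] [Nonempty Y] [Fintype A] [Nonempty A]
    (μ : X → ℝ) (hμ : IsPrior μ)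
    (α : X → Y → ℝ) (hα : IsKernel α)
    (u : X → A → ℝ)
    (β : Y → A → ℝ) (hβ : IsKernel β)
    (hopt : OptimalRule μ α u β) :
    JA μ (fun x a => ∑ y, β y a * α x y) u = J μ α u ∧
    J μ α u = ∑ x, ∑ a, (μ x * ∑ y, β y a * α x y) * u x a := by
  have hJ : J μ α u = ∑ a, ∑ x, (μ x * ∑ y, β y a * α x y) * u x a := by
    simp only [sum_garbled_mul]
    rw [Finset.sum_comm]
    refine Finset.sum_congr rfl fun y _ => ?_
    simp only [← hopt.mul_maxOver hβ]
    rw [← Finset.sum_mul, hβ.2 y, one_mul]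
  refine ⟨?_, hJ.trans Finset.sum_comm⟩
  rw [hJ]
  exact Finset.sum_congr rfl fun a _ => hopt.maxOver_garbled hβ a
end

section
/- Let X, A be finite nonempty sets, μ a prior on X, p_1,…,p_K stochastic kernels from X to A, u_1,…,u_K : X × A → ℝ utilities and c_1,…,c_K ∈ ℝ. Define the joints q_k(x,a) = μ(x) p_k(a|x) and suppose each q_k satisfies NIAS for u_k and q_1,…,q_K, u_1,…,u_K, c_1,…,c_K satisfy NIAC. Then the reconstructed cost C(p) = max_{1≤j≤K} [ c_j + J_A(μ, p, u_j) − J_A(μ, p_j, u_j) ] satisfies C(p_k) = c_k for every k ∈ {1,…,K}. -/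
open Finset

/-- The reconstructed information acquisition cost (BRP test). -/
noncomputable def reconCost {X A K : Type*} [Fintype X] [Fintype A] [Nonempty A]
    [Fintype K] [Nonempty K]
    (μ : X → ℝ) (p : K → X → A → ℝ) (u : K → X → A → ℝ) (c : K → ℝ)
    (p' : X → A → ℝ) : ℝ :=
  maxOver (fun k => c k + JA μ p' (u k) - JA μ (p k) (u k))

/-- Following the recommended action yields at most the maximal expected utility. -/
theorem sum_le_JA {X A : Type*} [Fintype X] [Fintype A] [Nonempty A]
    (μ : X → ℝ) (p u : X → A → ℝ) :
    ∑ x, ∑ a, μ x * p x a * u x a ≤ JA μ p u := by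
  rw [Finset.sum_comm]
  exact Finset.sum_le_sum fun a _ => le_maxOver (fun b => ∑ x, μ x * p x a * u x b) a

/-- Under NIAS and NIAC, the reconstructed cost evaluates to `c k` at `p k`. -/
theorem reconCost_eval {X A K : Type*} [Fintype X] [Nonempty X]
    [Fintype A] [Nonempty A] [Fintype K] [Nonempty K]
    (μ : X → ℝ) (hμ : IsPrior μ)
    (p : K → X → A → ℝ) (hp : ∀ k, IsKernel (p k))
    (u : K → X → A → ℝ) (c : K → ℝ)
    (hNIAS : ∀ k, NIAS (fun x a => μ x * p k x a) (u k))
    (hNIAC : NIAC (fun k x a => μ x * p k x a) u c) :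
    ∀ k, reconCost μ p u c (p k) = c k := by
  intro k
  apply le_antisymm
  · refine Finset.sup'_le Finset.univ_nonempty _ fun j _ => ?_
    have hcycle : JA μ (p k) (u j) - c k
        - (∑ x, ∑ a, μ x * p j x a * u j x a) + c j ≤ 0 := hNIAC k j
    have hself := sum_le_JA μ (p j) (u j)
    linarith
  · have hk := le_maxOver (fun j => c j + JA μ (p k) (u j) - JA μ (p j) (u j)) k
    simpa [reconCost] using hk
end

section
/- (Necessity for the single-utility S-BRP test.) Let X, Y, A be finite nonempty sets, μ a prior on X, u : X × A → ℝ a shared utility, C a real-valued function on stochastic kernels from X to Y, and λ_1,…,λ_K > 0. Suppose for each k ∈ {1,…,K}: α_k is a stochastic kernel from X to Y with J(μ, α_k, u) − λ_k C(α_k) ≥ J(μ, α, u) − λ_k C(α) for every stochastic kernel α from X to Y, and β_k is an optimal decision rule for (μ, α_k, u). Let q_k be the revealed joint distribution of (μ, α_k, β_k) and c_k = C(α_k). Then for all j, k ∈ {1,…,K}: ∑_{x∈X}∑_{a∈A} (q_j(x,a) − q_k(x,a)) u(x,a) + λ_k (c_k − c_j) ≤ 0. -/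
open Finset

/-- The expected utility of the revealed joint distribution of an optimal decision rule is the
maximal expected utility. -/
theorem OptimalRule.sum_revealed_eq_J {X Y A : Type*} [Fintype X] [Fintype Y] [Fintype A]
    [Nonempty A] {μ : X → ℝ} {α : X → Y → ℝ} {u : X → A → ℝ} {β : Y → A → ℝ}
    (hopt : OptimalRule μ α u β) (hβ : IsKernel β) :
    ∑ x, ∑ a, (μ x * ∑ y, β y a * α x y) * u x a = J μ α u := by
  have value (y : Y) : ∑ a, β y a * ∑ x, μ x * α x y * u x a
      = maxOver (fun a => ∑ x, μ x * α x y * u x a) := by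
    have eq_max (a : A) : β y a * ∑ x, μ x * α x y * u x a
        = β y a * maxOver (fun a => ∑ x, μ x * α x y * u x a) := by
      rcases (hβ.1 y a).eq_or_lt with h | h
      · simp [← h]
      · congr 1
        exact le_antisymm
          (Finset.le_sup' (fun a => ∑ x, μ x * α x y * u x a) (Finset.mem_univ a))
          (Finset.sup'_le _ _ fun b _ => hopt y a h b)
    rw [Finset.sum_congr rfl fun a _ => eq_max a, ← Finset.sum_mul, hβ.2 y, one_mul]
  calc ∑ x, ∑ a, (μ x * ∑ y, β y a * α x y) * u x a
      = ∑ x, ∑ a, ∑ y, β y a * (μ x * α x y * u x a) := by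
        refine Finset.sum_congr rfl fun x _ => Finset.sum_congr rfl fun a _ => ?_
        rw [Finset.mul_sum, Finset.sum_mul]
        exact Finset.sum_congr rfl fun y _ => by ring
    _ = ∑ x, ∑ y, ∑ a, β y a * (μ x * α x y * u x a) :=
        Finset.sum_congr rfl fun x _ => Finset.sum_comm
    _ = ∑ y, ∑ x, ∑ a, β y a * (μ x * α x y * u x a) := Finset.sum_comm
    _ = ∑ y, ∑ a, β y a * ∑ x, μ x * α x y * u x a := by
        refine Finset.sum_congr rfl fun y _ => ?_
        rw [Finset.sum_comm]
        exact Finset.sum_congr rfl fun a _ => (Finset.mul_sum _ _ _).symm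
    _ = J μ α u := Finset.sum_congr rfl fun y _ => value y

/-- Necessity for the single-utility S-BRP test. -/
theorem sbrp_necessity {X Y A K : Type*} [Fintype X] [Nonempty X]
    [Fintype Y] [Nonempty Y] [Fintype A] [Nonempty A] [Fintype K] [Nonempty K]
    (μ : X → ℝ) (hμ : IsPrior μ)
    (u : X → A → ℝ)
    (C : (X → Y → ℝ) → ℝ)
    (lam : K → ℝ) (hlam : ∀ k, 0 < lam k)
    (α : K → X → Y → ℝ) (hα : ∀ k, IsKernel (α k))
    (hatt : ∀ k, ∀ α' : X → Y → ℝ, IsKernel α' →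
      J μ α' u - lam k * C α' ≤ J μ (α k) u - lam k * C (α k))
    (β : K → Y → A → ℝ) (hβ : ∀ k, IsKernel (β k))
    (hopt : ∀ k, OptimalRule μ (α k) u (β k)) :
    ∀ j k, (∑ x, ∑ a, ((μ x * ∑ y, β j y a * α j x y) - (μ x * ∑ y, β k y a * α k x y)) * u x a)
      + lam k * (C (α k) - C (α j)) ≤ 0 := by
  intro j k
  simp only [sub_mul, Finset.sum_sub_distrib]
  rw [(hopt j).sum_revealed_eq_J (hβ j), (hopt k).sum_revealed_eq_J (hβ k)]
  linarith [hatt k (α j) (hα j)]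
end
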